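/- Let m ≥ 1, p ≥ 1, β ∈ [0,p], T₀ > 0 and T_ε = T₀/ε^β. Assume the exact solution ψ(t) = S_{e,t}(ψ₀) of the relativistic NLSE satisfies ψ ∈ L^∞([0,T_ε]; H^{m+1}(Ω)), and set R = ‖ψ‖_{L^∞([0,T_ε]; H^m)}. Then there exists τ₀ > 0 independent of ε such that for every ε ∈ (0,1] and every time step 0 < τ ≤ τ₀ ε^{(β−p)/2}, the Strang splitting iterates ψ^[n+1] = S_τ(ψ^[n]), ψ^[0] = ψ₀, satisfy ‖ψ^[n] − ψ(t_n)‖_m ≤ M₁ ε^{p−β} τ² and ‖ψ^[n]‖_m ≤ R + 1 for all 0 ≤ n ≤ (T₀/ε^β)/τ, where t_n = nτ and M₁ depends only on T₀, R and ‖ψ‖_{L^∞([0,T_ε]; H^{m+1})}. -/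

import Mathlib

/- Periodic functions on Ω = (a,b) are represented by their Fourier coefficient
sequences `c : ℤ → ℂ`, i.e. `z(x) = ∑_{l∈ℤ} c l * exp(i μ_l (x−a))` with
`μ_l = 2πl/(b−a)`.  All operators are expressed on the Fourier side:
`⟨∇⟩`, `⟨∇⟩⁻¹`, `e^{it⟨∇⟩}` act diagonally, complex conjugation of the function
corresponds to `l ↦ conj (c (−l))`, and the pointwise product of two functions
corresponds to the convolution of their coefficient sequences. -/

noncomputable section

namespace NKGE

/-- Fourier frequency `μ_l = 2πl/(b−a)`. -/
def mu (a b : ℝ) (l : ℤ) : ℝ := 2 * Real.pi * l / (b - a)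

/-- `ζ_l = √(1+μ_l²)`, the Fourier symbol of `⟨∇⟩ = √(1−∂_xx)`. -/
def zeta (a b : ℝ) (l : ℤ) : ℝ := Real.sqrt (1 + mu a b l ^ 2)

/-- Squared `H^s`-norm: `‖z‖_s² = ∑_l (1+μ_l²)^s |ẑ_l|²`. -/
def sobNormSq (a b s : ℝ) (c : ℤ → ℂ) : ℝ := ∑' l : ℤ, (1 + mu a b l ^ 2) ^ s * ‖c l‖ ^ 2

/-- The `H^s`-norm `‖z‖_s`. -/
def sobNorm (a b s : ℝ) (c : ℤ → ℂ) : ℝ := Real.sqrt (sobNormSq a b s c)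

/-- Membership in `H^s(Ω)`. -/
def MemHs (a b s : ℝ) (c : ℤ → ℂ) : Prop :=
  Summable fun l : ℤ => (1 + mu a b l ^ 2) ^ s * ‖c l‖ ^ 2

/-- The operator `⟨∇⟩` acting in Fourier space. -/
def opJ (a b : ℝ) (c : ℤ → ℂ) : ℤ → ℂ := fun l => (zeta a b l : ℂ) * c l

/-- The operator `⟨∇⟩⁻¹` acting in Fourier space. -/
def opJinv (a b : ℝ) (c : ℤ → ℂ) : ℤ → ℂ := fun l => c l / (zeta a b l : ℂ)

/-- The operator `e^{it⟨∇⟩}` acting in Fourier space. -/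
def expJ (a b t : ℝ) (c : ℤ → ℂ) : ℤ → ℂ :=
  fun l => Complex.exp (Complex.I * (t : ℂ) * (zeta a b l : ℂ)) * c l

/-- Fourier coefficients of the complex conjugate function `z̄`. -/
def conjC (c : ℤ → ℂ) : ℤ → ℂ := fun l => (starRingEnd ℂ) (c (-l))

/-- Convolution of coefficient sequences = coefficients of the pointwise product. -/
def convC (c d : ℤ → ℂ) : ℤ → ℂ := fun l => ∑' m : ℤ, c m * d (l - m)

/-- Coefficients of the constant function `1`. -/
def oneC : ℤ → ℂ := fun l => if l = 0 then 1 else 0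

/-- Coefficients of the `n`-th pointwise power `z^n`. -/
def powC (c : ℤ → ℂ) : ℕ → ℤ → ℂ
  | 0 => oneC
  | n + 1 => convC c (powC c n)

/-- Coefficients of `(ψ + ψ̄)/2`. -/
def reC (c : ℤ → ℂ) : ℤ → ℂ := fun l => (c l + conjC c l) / 2

/-- Coefficients of `φ + φ̄`. -/
def addConj (c : ℤ → ℂ) : ℤ → ℂ := fun l => c l + conjC c l

/-- `G(φ) = f((φ+φ̄)/2)` with `f(v) = v^{p+1}`. -/
def Gop (p : ℕ) (c : ℤ → ℂ) : ℤ → ℂ := powC (reC c) (p + 1)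

/-- `F(φ) = i ⟨∇⟩⁻¹ G(φ)`. -/
def Fop (a b : ℝ) (p : ℕ) (c : ℤ → ℂ) : ℤ → ℂ := fun l => Complex.I * opJinv a b (Gop p c) l

/-- `F_t(φ) = e^{−it⟨∇⟩} F(e^{it⟨∇⟩} φ)`. -/
def Ft (a b : ℝ) (p : ℕ) (t : ℝ) (c : ℤ → ℂ) : ℤ → ℂ :=
  expJ a b (-t) (Fop a b p (expJ a b t c))

/-- `F'(φ)(η) = ((p+1)i/2^{p+1}) ⟨∇⟩⁻¹((φ+φ̄)^p (η+η̄))`. -/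
def Fd (a b : ℝ) (p : ℕ) (φ η : ℤ → ℂ) : ℤ → ℂ :=
  fun l => ((p : ℂ) + 1) * Complex.I / 2 ^ (p + 1) *
    opJinv a b (convC (powC (addConj φ) p) (addConj η)) l

/-- `F_t'(φ)(η) = e^{−it⟨∇⟩} F'(e^{it⟨∇⟩}φ)(e^{it⟨∇⟩}η)`. -/
def Ftd (a b : ℝ) (p : ℕ) (t : ℝ) (φ η : ℤ → ℂ) : ℤ → ℂ :=
  expJ a b (-t) (Fd a b p (expJ a b t φ) (expJ a b t η))

/-- `F''(φ)(η,ζ) = (p(p+1)i/2^{p+1}) ⟨∇⟩⁻¹((φ+φ̄)^{p−1}(η+η̄)(ζ+ζ̄))`. -/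
def Fdd (a b : ℝ) (p : ℕ) (φ η ζ : ℤ → ℂ) : ℤ → ℂ :=
  fun l => (p : ℂ) * ((p : ℂ) + 1) * Complex.I / 2 ^ (p + 1) *
    opJinv a b (convC (convC (powC (addConj φ) (p - 1)) (addConj η)) (addConj ζ)) l

/-- `F_t''(φ)(η,ζ) = e^{−it⟨∇⟩} F''(e^{it⟨∇⟩}φ)(e^{it⟨∇⟩}η, e^{it⟨∇⟩}ζ)`. -/
def Ftdd (a b : ℝ) (p : ℕ) (t : ℝ) (φ η ζ : ℤ → ℂ) : ℤ → ℂ :=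
  expJ a b (-t) (Fdd a b p (expJ a b t φ) (expJ a b t η) (expJ a b t ζ))

/-- The flow `φ_V^t(ψ₀) = ψ₀ + ε^p t F(ψ₀)` of the nonlinear subproblem. -/
def flowV (a b : ℝ) (p : ℕ) (ε t : ℝ) (c : ℤ → ℂ) : ℤ → ℂ :=
  fun l => c l + (ε ^ p * t) • Fop a b p c l

/-- The Strang splitting operator `S_τ = φ_T^{τ/2} ∘ φ_V^{τ} ∘ φ_T^{τ/2}`. -/
def strang (a b : ℝ) (p : ℕ) (ε τ : ℝ) (c : ℤ → ℂ) : ℤ → ℂ :=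
  expJ a b (τ / 2) (flowV a b p ε τ (expJ a b (τ / 2) c))

/-- The alternative Strang splitting `S̃_τ = φ_V^{τ/2} ∘ φ_T^{τ} ∘ φ_V^{τ/2}`. -/
def strang2 (a b : ℝ) (p : ℕ) (ε τ : ℝ) (c : ℤ → ℂ) : ℤ → ℂ :=
  flowV a b p ε (τ / 2) (expJ a b τ (flowV a b p ε (τ / 2) c))

/-- `Ψ` is an exact solution of the relativistic NLSE
`i∂_tψ + ⟨∇⟩ψ + ε^p ⟨∇⟩⁻¹ G(ψ) = 0`, written on the Fourier side, i.e.
`ψ' = i(ζ_l ψ_l + ε^p ζ_l⁻¹ (G(ψ))_l)`. -/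
def IsExactSol (a b : ℝ) (p : ℕ) (ε : ℝ) (Ψ : ℝ → ℤ → ℂ) : Prop :=
  ∀ (t : ℝ) (l : ℤ), HasDerivAt (fun s => Ψ s l)
    (Complex.I * ((zeta a b l : ℂ) * Ψ t l + (ε ^ p : ℂ) * Gop p (Ψ t) l / (zeta a b l : ℂ))) t

/-- Pointwise-in-`t` derivative `∂_t F_t(φ)`. -/
def dFt (a b : ℝ) (p : ℕ) (t : ℝ) (c : ℤ → ℂ) : ℤ → ℂ :=
  fun l => deriv (fun τ => Ft a b p τ c l) t

/-- Second derivative `∂_t² F_t(φ)`. -/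
def d2Ft (a b : ℝ) (p : ℕ) (t : ℝ) (c : ℤ → ℂ) : ℤ → ℂ :=
  fun l => deriv (fun τ => dFt a b p τ c l) t

/-- Derivative `∂_t F_t'(φ)(η)`. -/
def dFtd (a b : ℝ) (p : ℕ) (t : ℝ) (φ η : ℤ → ℂ) : ℤ → ℂ :=
  fun l => deriv (fun τ => Ftd a b p τ φ η l) t

def L2 (f : ℤ → ℝ) (B : ℝ) : Prop := 0 ≤ B ∧ ∀ S : Finset ℤ, ∑ l ∈ S, f l ^ 2 ≤ B ^ 2
def L1 (f : ℤ → ℝ) (B : ℝ) : Prop := ∀ S : Finset ℤ, ∑ l ∈ S, |f l| ≤ B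
def cv (f g : ℤ → ℝ) (l : ℤ) : ℝ := ∑' k : ℤ, f k * g (l - k)
def W (a b s : ℝ) (f : ℤ → ℝ) (B : ℝ) : Prop :=
  (∀ l, 0 ≤ f l) ∧ L2 (fun l => zeta a b l ^ s * f l) B
def Bd (a b s : ℝ) (c : ℤ → ℂ) (B : ℝ) : Prop := W a b s (fun l => ‖c l‖) B

lemma L2.mono {f g : ℤ → ℝ} {A B : ℝ} (hg : L2 g A) (h : ∀ l, |f l| ≤ g l) (hAB : A ≤ B) :
    L2 f B := by
  refine ⟨hg.1.trans hAB, fun S => ?_⟩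
  calc ∑ l ∈ S, f l ^ 2 ≤ ∑ l ∈ S, g l ^ 2 := by
        apply Finset.sum_le_sum
        intro l _
        rw [← sq_abs]
        exact pow_le_pow_left₀ (abs_nonneg _) (h l) 2
    _ ≤ A ^ 2 := hg.2 S
    _ ≤ B ^ 2 := pow_le_pow_left₀ hg.1 hAB 2

lemma L2.add {f g : ℤ → ℝ} {A B : ℝ} (hf : L2 f A) (hg : L2 g B) :
    L2 (fun l => f l + g l) (A + B) := by
  refine ⟨add_nonneg hf.1 hg.1, fun S => ?_⟩
  have h1 := hf.2 S
  have h2 := hg.2 S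
  have h3 := Finset.sum_mul_sq_le_sq_mul_sq S f g
  have h4 : (∑ l ∈ S, f l * g l) ^ 2 ≤ (A * B) ^ 2 := by
    rw [mul_pow]
    refine h3.trans (mul_le_mul h1 h2 (Finset.sum_nonneg fun _ _ => sq_nonneg _) (sq_nonneg _))
  have h5 : ∑ l ∈ S, f l * g l ≤ A * B :=
    le_of_sq_le_sq h4 (mul_nonneg hf.1 hg.1)
  have h6 : ∑ l ∈ S, (f l + g l) ^ 2
      = ∑ l ∈ S, f l ^ 2 + 2 * ∑ l ∈ S, f l * g l + ∑ l ∈ S, g l ^ 2 := by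
    rw [Finset.mul_sum, ← Finset.sum_add_distrib, ← Finset.sum_add_distrib]
    exact Finset.sum_congr rfl fun _ _ => by ring
  rw [h6]; nlinarith

lemma L2.smul {f : ℤ → ℝ} {A : ℝ} (hf : L2 f A) {r : ℝ} (hr : 0 ≤ r) :
    L2 (fun l => r * f l) (r * A) := by
  refine ⟨mul_nonneg hr hf.1, fun S => ?_⟩
  simp only [mul_pow, ← Finset.mul_sum]
  exact mul_le_mul_of_nonneg_left (hf.2 S) (sq_nonneg r)

lemma L2.comp {f : ℤ → ℝ} {A : ℝ} (hf : L2 f A) (e : ℤ ≃ ℤ) : L2 (fun l => f (e l)) A := by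
  refine ⟨hf.1, fun S => ?_⟩
  have := hf.2 (S.map e.toEmbedding)
  simpa [Finset.sum_map] using this

lemma L2.summable {f : ℤ → ℝ} {A : ℝ} (hf : L2 f A) : Summable (fun l => f l ^ 2) :=
  summable_of_sum_le (fun _ => sq_nonneg _) hf.2

lemma L2.summable_mul {f g : ℤ → ℝ} {A B : ℝ} (hf : L2 f A) (hg : L2 g B) (l : ℤ) :
    Summable (fun k => f k * g (l - k)) := by
  have h1 := hf.summable
  have h2 := (hg.comp (Equiv.subLeft l)).summable
  refine Summable.of_norm_bounded (h1.add h2) fun k => ?_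
  simp only [Equiv.subLeft_apply, Real.norm_eq_abs, abs_mul]
  have := sq_nonneg (|f k| - |g (l - k)|)
  rw [← sq_abs (f k), ← sq_abs (g (l - k))]
  nlinarith [sq_nonneg (|f k|), sq_nonneg (|g (l-k)|)]

lemma cv_comm (f g : ℤ → ℝ) : cv f g = cv g f := by
  funext l
  unfold cv
  rw [← (Equiv.subLeft l).tsum_eq]
  simp [mul_comm]

lemma young {f g : ℤ → ℝ} {A B C : ℝ} (hf : L1 f A) (hf2 : L2 f C) (hg : L2 g B) :
    L2 (cv f g) (A * B) := by
  have hA : 0 ≤ A := by simpa using hf ∅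
  refine ⟨mul_nonneg hA hg.1, fun S => ?_⟩
  have key : ∀ Q : Finset ℤ, ∑ l ∈ S, (∑ k ∈ Q, f k * g (l - k)) ^ 2 ≤ (A * B) ^ 2 := by
    intro Q
    calc ∑ l ∈ S, (∑ k ∈ Q, f k * g (l - k)) ^ 2
        ≤ ∑ l ∈ S, (∑ k ∈ Q, |f k|) * ∑ k ∈ Q, |f k| * g (l - k) ^ 2 := by
          apply Finset.sum_le_sum
          intro l _
          apply Finset.sum_sq_le_sum_mul_sum_of_sq_le_mul
          · intros; positivity
          · intros; positivity
          · intro k _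
            apply le_of_eq
            rw [mul_pow, ← sq_abs (f k)]; ring
      _ = (∑ k ∈ Q, |f k|) * ∑ k ∈ Q, |f k| * ∑ l ∈ S, g (l - k) ^ 2 := by
          rw [← Finset.mul_sum, Finset.sum_comm]
          simp only [Finset.mul_sum]
      _ ≤ A * ∑ k ∈ Q, |f k| * B ^ 2 := by
          apply mul_le_mul (hf Q) _ _ hA
          · apply Finset.sum_le_sum
            intro k _
            exact mul_le_mul_of_nonneg_left ((hg.comp (Equiv.subRight k)).2 S) (abs_nonneg _)
          · positivity
      _ ≤ A * (A * B ^ 2) := by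
          rw [← Finset.sum_mul]
          gcongr
          exact hf Q
      _ = (A * B) ^ 2 := by ring
  have lim : Filter.Tendsto (fun Q : Finset ℤ => ∑ l ∈ S, (∑ k ∈ Q, f k * g (l - k)) ^ 2)
      Filter.atTop (nhds (∑ l ∈ S, cv f g l ^ 2)) := by
    apply tendsto_finsetSum
    intro l _
    exact ((hf2.summable_mul hg l).hasSum).pow 2
  exact le_of_tendsto' lim key

section
variable {a b : ℝ}

lemma zeta_ge (l : ℤ) : 1 ≤ zeta a b l := by
  unfold zeta
  rw [Real.one_le_sqrt]; nlinarith [sq_nonneg (mu a b l)]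
lemma zeta_pos (l : ℤ) : 0 < zeta a b l := lt_of_lt_of_le one_pos (zeta_ge l)
lemma zeta_sq (l : ℤ) : zeta a b l ^ 2 = 1 + mu a b l ^ 2 := by
  unfold zeta
  rw [Real.sq_sqrt (by positivity)]
lemma zeta_neg (l : ℤ) : zeta a b (-l) = zeta a b l := by
  unfold zeta mu
  push_cast
  congr 2
  ring
lemma zeta_zero : zeta a b 0 = 1 := by simp [zeta, mu]
lemma zeta_add (l k : ℤ) : zeta a b l ≤ zeta a b k + zeta a b (l - k) := by
  have hm : mu a b l = mu a b k + mu a b (l - k) := by unfold mu; push_cast; ring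
  have h1 := zeta_pos (a := a) (b := b) k
  have h2 := zeta_pos (a := a) (b := b) (l - k)
  apply le_of_sq_le_sq _ (by positivity)
  have e1 := zeta_sq (a := a) (b := b) k
  have e2 := zeta_sq (a := a) (b := b) (l - k)
  have h3 : mu a b k * mu a b (l - k) ≤ zeta a b k * zeta a b (l - k) := by
    apply le_of_sq_le_sq _ (by positivity)
    rw [mul_pow, mul_pow, e1, e2]
    nlinarith [sq_nonneg (mu a b k), sq_nonneg (mu a b (l - k))]
  rw [zeta_sq, hm]
  nlinarith

lemma zeta_rpow_ge {s : ℝ} (hs : 0 ≤ s) (l : ℤ) : 1 ≤ zeta a b l ^ s :=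
  Real.one_le_rpow (zeta_ge l) hs
lemma zeta_rpow_pos (s : ℝ) (l : ℤ) : 0 < zeta a b l ^ s := Real.rpow_pos_of_pos (zeta_pos l) s

lemma zeta_rpow_add {s : ℝ} (hs : 0 ≤ s) (l k : ℤ) :
    zeta a b l ^ s ≤ 2 ^ s * (zeta a b k ^ s + zeta a b (l - k) ^ s) := by
  have h1 := zeta_pos (a := a) (b := b) k
  have h2 := zeta_pos (a := a) (b := b) (l - k)
  have h0 := zeta_pos (a := a) (b := b) l
  have h := zeta_add (a := a) (b := b) l k
  have q1 := zeta_rpow_pos (a := a) (b := b) s k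
  have q2 := zeta_rpow_pos (a := a) (b := b) s (l - k)
  rcases le_total (zeta a b k) (zeta a b (l - k)) with h3 | h3
  · calc zeta a b l ^ s ≤ (2 * zeta a b (l - k)) ^ s :=
          Real.rpow_le_rpow h0.le (by linarith) hs
      _ = 2 ^ s * zeta a b (l - k) ^ s := Real.mul_rpow (by norm_num) h2.le
      _ ≤ _ := by gcongr; linarith
  · calc zeta a b l ^ s ≤ (2 * zeta a b k) ^ s :=
          Real.rpow_le_rpow h0.le (by linarith) hs
      _ = 2 ^ s * zeta a b k ^ s := Real.mul_rpow (by norm_num) h1.le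
      _ ≤ _ := by gcongr; linarith

lemma zeta_summable (hab : a < b) : Summable (fun l : ℤ => (zeta a b l)⁻¹ ^ 2) := by
  have h := (Real.summable_one_div_int_pow (p := 2)).2 (by norm_num)
  have h2 := h.mul_left (((b - a) / (2 * Real.pi)) ^ 2)
  have hd : 0 < b - a := by linarith
  refine h2.of_norm_bounded_eventually ?_
  filter_upwards [(Set.finite_singleton (0 : ℤ)).compl_mem_cofinite] with l hl
  have hl' : (l : ℝ) ≠ 0 := by
    have : l ≠ 0 := by simpa using hl
    exact_mod_cast this
  rw [Real.norm_of_nonneg (by positivity), inv_pow, zeta_sq]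
  have hm : 0 < mu a b l ^ 2 := by
    unfold mu; have := Real.pi_pos; positivity
  calc (1 + mu a b l ^ 2)⁻¹ ≤ (mu a b l ^ 2)⁻¹ := by gcongr; linarith
    _ = _ := by unfold mu; have := Real.pi_pos; field_simp

lemma W.mono {s : ℝ} {f g : ℤ → ℝ} {A B : ℝ} (hg : W a b s g A) (h0 : ∀ l, 0 ≤ f l)
    (h : ∀ l, f l ≤ g l) (hAB : A ≤ B) : W a b s f B := by
  refine ⟨h0, hg.2.mono (fun l => ?_) hAB⟩
  have := zeta_rpow_pos (a := a) (b := b) s l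
  rw [abs_of_nonneg (mul_nonneg this.le (h0 l))]
  exact mul_le_mul_of_nonneg_left (h l) this.le

lemma W.add {s : ℝ} {f g : ℤ → ℝ} {A B : ℝ} (hf : W a b s f A) (hg : W a b s g B) :
    W a b s (fun l => f l + g l) (A + B) := by
  refine ⟨fun l => add_nonneg (hf.1 l) (hg.1 l), (hf.2.add hg.2).mono (fun l => ?_) le_rfl⟩
  have := zeta_rpow_pos (a := a) (b := b) s l
  rw [abs_of_nonneg (mul_nonneg this.le (add_nonneg (hf.1 l) (hg.1 l))), mul_add]

lemma W.smul {s : ℝ} {f : ℤ → ℝ} {A r : ℝ} (hf : W a b s f A) (hr : 0 ≤ r) :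
    W a b s (fun l => r * f l) (r * A) := by
  refine ⟨fun l => mul_nonneg hr (hf.1 l), (hf.2.smul hr).mono (fun l => ?_) le_rfl⟩
  have := zeta_rpow_pos (a := a) (b := b) s l
  rw [abs_of_nonneg (mul_nonneg this.le (mul_nonneg hr (hf.1 l)))]
  apply le_of_eq; ring

lemma W.down {s r : ℝ} {f : ℤ → ℝ} {A : ℝ} (hf : W a b s f A) (h : r ≤ s) : W a b r f A := by
  refine ⟨hf.1, hf.2.mono (fun l => ?_) le_rfl⟩
  have := zeta_rpow_pos (a := a) (b := b) r l
  rw [abs_of_nonneg (mul_nonneg this.le (hf.1 l))]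
  exact mul_le_mul_of_nonneg_right (Real.rpow_le_rpow_of_exponent_le (zeta_ge l) h) (hf.1 l)

/-- multiply by zeta -/
lemma W.zmul {s : ℝ} {f : ℤ → ℝ} {A : ℝ} (hf : W a b (s + 1) f A) :
    W a b s (fun l => zeta a b l * f l) A := by
  refine ⟨fun l => mul_nonneg (zeta_pos l).le (hf.1 l), hf.2.mono (fun l => ?_) le_rfl⟩
  have := zeta_rpow_pos (a := a) (b := b) s l
  have h2 := zeta_pos (a := a) (b := b) l
  rw [abs_of_nonneg (mul_nonneg this.le (mul_nonneg h2.le (hf.1 l))), Real.rpow_add_one h2.ne']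
  apply le_of_eq; ring

lemma W.zdiv {s : ℝ} {f : ℤ → ℝ} {A : ℝ} (hf : W a b s f A) :
    W a b (s + 1) (fun l => f l / zeta a b l) A := by
  refine ⟨fun l => div_nonneg (hf.1 l) (zeta_pos l).le, hf.2.mono (fun l => ?_) le_rfl⟩
  have := zeta_rpow_pos (a := a) (b := b) (s + 1) l
  have h2 := zeta_pos (a := a) (b := b) l
  rw [abs_of_nonneg (mul_nonneg this.le (div_nonneg (hf.1 l) h2.le)), Real.rpow_add_one h2.ne']
  apply le_of_eq; field_simp

lemma W.neg {s : ℝ} {f : ℤ → ℝ} {A : ℝ} (hf : W a b s f A) : W a b s (fun l => f (-l)) A := by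
  refine ⟨fun l => hf.1 _, (hf.2.comp (Equiv.neg ℤ)).mono (fun l => ?_) le_rfl⟩
  have := zeta_rpow_pos (a := a) (b := b) s l
  rw [abs_of_nonneg (mul_nonneg this.le (hf.1 _))]
  simp [zeta_neg]

lemma W.L2 {s : ℝ} {f : ℤ → ℝ} {A : ℝ} (hf : W a b s f A) (hs : 0 ≤ s) : L2 f A := by
  have := (hf.down hs).2
  simpa using this

lemma exists_L1 (hab : a < b) : ∃ C, 0 ≤ C ∧ ∀ (f : ℤ → ℝ) (A : ℝ), W a b 1 f A → L1 f (C * A) := by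
  have hs := zeta_summable hab
  refine ⟨Real.sqrt (∑' l : ℤ, (zeta a b l)⁻¹ ^ 2), Real.sqrt_nonneg _, fun f A hf S => ?_⟩
  have h1 := Finset.sum_mul_sq_le_sq_mul_sq S (fun l => (zeta a b l)⁻¹)
    (fun l => zeta a b l ^ (1 : ℝ) * f l)
  have h2 := hf.2.2 S
  have h3 : ∑ l ∈ S, (zeta a b l)⁻¹ ^ 2 ≤ ∑' l : ℤ, (zeta a b l)⁻¹ ^ 2 :=
    hs.sum_le_tsum S (fun _ _ => sq_nonneg _)
  have h0 : 0 ≤ ∑' l : ℤ, (zeta a b l)⁻¹ ^ 2 := tsum_nonneg fun _ => sq_nonneg _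
  apply le_of_sq_le_sq _ (mul_nonneg (Real.sqrt_nonneg _) hf.2.1)
  rw [mul_pow, Real.sq_sqrt h0]
  refine le_trans (le_of_eq ?_) (h1.trans (mul_le_mul h3 h2 (Finset.sum_nonneg fun _ _ => sq_nonneg _) h0))
  congr 1
  apply Finset.sum_congr rfl
  intro l _
  have := zeta_pos (a := a) (b := b) l
  rw [abs_of_nonneg (hf.1 l), Real.rpow_one]
  field_simp

lemma cv_weight {s : ℝ} (hs : 0 ≤ s) {f g : ℤ → ℝ} (hf : ∀ l, 0 ≤ f l) (hg : ∀ l, 0 ≤ g l)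
    (l : ℤ) (h1 : Summable (fun k => (zeta a b k ^ s * f k) * g (l - k)))
    (h2 : Summable (fun k => f k * (zeta a b (l - k) ^ s * g (l - k)))) :
    zeta a b l ^ s * cv f g l ≤ 2 ^ s * (cv (fun k => zeta a b k ^ s * f k) g l +
      cv f (fun k => zeta a b k ^ s * g k) l) := by
  unfold cv
  rw [← Summable.tsum_add h1 h2, ← tsum_mul_left, ← tsum_mul_left]
  have hle : ∀ k, zeta a b l ^ s * (f k * g (l - k)) ≤
     2 ^ s * ((zeta a b k ^ s * f k) * g (l - k) + f k * (zeta a b (l - k) ^ s * g (l - k))) := by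
    intro k
    have := mul_le_mul_of_nonneg_right (zeta_rpow_add (a := a) (b := b) hs l k)
      (mul_nonneg (hf k) (hg (l - k)))
    refine this.trans (le_of_eq (by ring))
  have hsum := (h1.add h2).mul_left (2 ^ s)
  refine Summable.tsum_le_tsum hle (Summable.of_nonneg_of_le (fun k => ?_) hle hsum) hsum
  exact mul_nonneg (zeta_rpow_pos s l).le (mul_nonneg (hf k) (hg _))

lemma cv_nonneg {f g : ℤ → ℝ} (hf : ∀ l, 0 ≤ f l) (hg : ∀ l, 0 ≤ g l) (l : ℤ) : 0 ≤ cv f g l :=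
  tsum_nonneg fun _ => mul_nonneg (hf _) (hg _)

/-- algebra property -/
lemma exists_P1 (hab : a < b) (s : ℝ) (hs : 1 ≤ s) : ∃ C, 0 ≤ C ∧ ∀ (f g : ℤ → ℝ) (A B : ℝ),
    W a b s f A → W a b s g B → W a b s (cv f g) (C * (A * B)) := by
  obtain ⟨C, hC, h⟩ := exists_L1 hab
  refine ⟨2 ^ s * (C + C), by positivity, fun f g A B hf hg => ?_⟩
  have hs0 : 0 ≤ s := by linarith
  have f1 := h f A (hf.down hs)
  have g1 := h g B (hg.down hs)
  have f2 := hf.L2 hs0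
  have g2 := hg.L2 hs0
  have y1 := young g1 g2 hf.2
  have y2 := young f1 f2 hg.2
  rw [cv_comm] at y1
  refine ⟨cv_nonneg hf.1 hg.1, ((y1.add y2).smul (r := 2 ^ s) (by positivity)).mono (fun l => ?_)
    (le_of_eq (by ring))⟩
  rw [abs_of_nonneg (mul_nonneg (zeta_rpow_pos s l).le (cv_nonneg hf.1 hg.1 l))]
  exact cv_weight hs0 hf.1 hg.1 l (hf.2.summable_mul g2 l) (f2.summable_mul hg.2 l)

lemma exists_P2 (hab : a < b) (s : ℝ) (hs : 0 ≤ s) : ∃ C, 0 ≤ C ∧ ∀ (f g : ℤ → ℝ) (A B : ℝ),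
    W a b (s + 1) f A → W a b s g B → W a b s (cv f g) (C * (A * B)) := by
  obtain ⟨C, hC, h⟩ := exists_L1 hab
  refine ⟨2 ^ s * (C + C), by positivity, fun f g A B hf hg => ?_⟩
  have f1 := h f A (hf.down (by linarith))
  have hfs : W a b 1 (fun l => zeta a b l ^ s * f l) A := by
    refine ⟨fun l => mul_nonneg (zeta_rpow_pos s l).le (hf.1 l), hf.2.mono (fun l => ?_) le_rfl⟩
    have h2 := zeta_pos (a := a) (b := b) l
    have h3 := zeta_rpow_pos (a := a) (b := b) s l
    have h4 := hf.1 l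
    rw [abs_of_nonneg (by positivity), Real.rpow_add_one h2.ne', Real.rpow_one]
    apply le_of_eq; ring
  have f1s := h _ A hfs
  have f2 := hf.L2 (by linarith)
  have g2 := hg.L2 hs
  have f2s := (hf.down (r := s) (by linarith)).2
  have y1 := young f1s f2s g2
  have y2 := young f1 f2 hg.2
  refine ⟨cv_nonneg hf.1 hg.1, ((y1.add y2).smul (r := 2 ^ s) (by positivity)).mono (fun l => ?_)
    (le_of_eq (by ring))⟩
  rw [abs_of_nonneg (mul_nonneg (zeta_rpow_pos s l).le (cv_nonneg hf.1 hg.1 l))]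
  exact cv_weight hs hf.1 hg.1 l (f2s.summable_mul g2 l) (f2.summable_mul hg.2 l)
end
section
variable {a b : ℝ}

lemma Bd.of_W {s : ℝ} {f : ℤ → ℝ} {c : ℤ → ℂ} {A B : ℝ} (hf : W a b s f A)
    (h : ∀ l, ‖c l‖ ≤ f l) (hAB : A ≤ B) : Bd a b s c B :=
  W.mono hf (fun _ => norm_nonneg _) h hAB

lemma Bd.mono {s : ℝ} {c : ℤ → ℂ} {A B : ℝ} (hf : Bd a b s c A) (hAB : A ≤ B) : Bd a b s c B :=
  Bd.of_W hf (fun _ => le_rfl) hAB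

lemma Bd.nonneg {s : ℝ} {c : ℤ → ℂ} {A : ℝ} (hf : Bd a b s c A) : 0 ≤ A := hf.2.1

lemma Bd.add {s : ℝ} {c d : ℤ → ℂ} {A B : ℝ} (hf : Bd a b s c A) (hg : Bd a b s d B) :
    Bd a b s (fun l => c l + d l) (A + B) :=
  Bd.of_W (W.add hf hg) (fun _ => norm_add_le _ _) le_rfl

lemma Bd.sub {s : ℝ} {c d : ℤ → ℂ} {A B : ℝ} (hf : Bd a b s c A) (hg : Bd a b s d B) :
    Bd a b s (fun l => c l - d l) (A + B) :=
  Bd.of_W (W.add hf hg) (fun _ => norm_sub_le _ _) le_rfl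

lemma norm_ph (t x : ℝ) : ‖Complex.exp (Complex.I * (t : ℂ) * (x : ℂ))‖ = 1 := by
  rw [mul_assoc, ← Complex.ofReal_mul, Complex.norm_exp_I_mul_ofReal]

lemma norm_expJ (t : ℝ) (c : ℤ → ℂ) (l : ℤ) : ‖expJ a b t c l‖ = ‖c l‖ := by
  simp only [expJ, norm_mul, norm_ph, one_mul]

lemma Bd.expJ {s : ℝ} {c : ℤ → ℂ} {A : ℝ} (hf : Bd a b s c A) (t : ℝ) :
    Bd a b s (expJ a b t c) A :=
  Bd.of_W hf (fun l => (norm_expJ t c l).le) le_rfl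

lemma norm_reC_le (c : ℤ → ℂ) (l : ℤ) : ‖reC c l‖ ≤ (1 / 2) * (‖c l‖ + ‖c (-l)‖) := by
  unfold reC conjC
  rw [norm_div]
  have h := norm_add_le (c l) ((starRingEnd ℂ) (c (-l)))
  rw [RCLike.norm_conj] at h
  simp only [Complex.norm_ofNat]
  linarith

lemma Bd.reC {s : ℝ} {c : ℤ → ℂ} {A : ℝ} (hf : Bd a b s c A) : Bd a b s (reC c) A :=
  Bd.of_W ((W.add hf (W.neg hf)).smul (r := 1 / 2) (by norm_num)) (norm_reC_le c)
    (le_of_eq (by ring))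

lemma reC_sub (c d : ℤ → ℂ) (l : ℤ) : reC c l - reC d l = reC (fun l => c l - d l) l := by
  simp only [NKGE.reC, conjC, map_sub]; ring

lemma Bd.L2 {s : ℝ} {c : ℤ → ℂ} {A : ℝ} (hf : Bd a b s c A) (hs : 0 ≤ s) :
    L2 (fun l => ‖c l‖) A := W.L2 hf hs

lemma convC_summable {c d : ℤ → ℂ} {f g : ℤ → ℝ} {A B : ℝ} (hf : L2 f A) (hg : L2 g B)
    (hc : ∀ l, ‖c l‖ ≤ f l) (hd : ∀ l, ‖d l‖ ≤ g l) (l : ℤ) :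
    Summable (fun k => c k * d (l - k)) := by
  refine Summable.of_norm_bounded (hf.summable_mul hg l) fun k => ?_
  rw [norm_mul]
  exact mul_le_mul (hc _) (hd _) (norm_nonneg _) ((norm_nonneg _).trans (hc _))

lemma norm_convC_le {c d : ℤ → ℂ} {f g : ℤ → ℝ} {A B r q : ℝ} (hf : L2 f A) (hg : L2 g B)
    (hc : ∀ l, ‖c l‖ ≤ r * f l) (hd : ∀ l, ‖d l‖ ≤ q * g l) (l : ℤ) :
    ‖convC c d l‖ ≤ r * q * cv f g l := by
  have hb : ∀ k, ‖c k * d (l - k)‖ ≤ r * q * (f k * g (l - k)) := by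
    intro k
    rw [norm_mul]
    exact (mul_le_mul (hc _) (hd _) (norm_nonneg _) ((norm_nonneg _).trans (hc _))).trans
      (le_of_eq (by ring))
  unfold convC cv
  rw [← tsum_mul_left]
  exact tsum_of_norm_bounded ((hf.summable_mul hg l).mul_left (r * q)).hasSum hb

/-- product in H^s -/
lemma exists_Bd_conv (hab : a < b) (s : ℝ) (hs : 1 ≤ s) : ∃ C, 0 ≤ C ∧ ∀ (c d : ℤ → ℂ) (A B : ℝ),
    Bd a b s c A → Bd a b s d B → Bd a b s (convC c d) (C * (A * B)) := by
  obtain ⟨C, hC, h⟩ := exists_P1 hab s hs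
  refine ⟨C, hC, fun c d A B hc hd => ?_⟩
  refine Bd.of_W (h _ _ A B hc hd) (fun l => ?_) le_rfl
  have := norm_convC_le (c := c) (d := d) (r := 1) (q := 1) (hc.L2 (by linarith)) (hd.L2 (by linarith))
    (fun l => by simp) (fun l => by simp) l
  simpa using this

lemma W_oneC (s : ℝ) : W a b s (fun l => if l = 0 then 1 else 0) 1 := by
  refine ⟨fun l => by dsimp only; split_ifs <;> norm_num, zero_le_one, fun S => ?_⟩
  have : ∀ l ∈ S, (zeta a b l ^ s * (if l = 0 then (1 : ℝ) else 0)) ^ 2 = if l = 0 then 1 else 0 := by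
    intro l _
    by_cases h : l = 0
    · subst h; simp [zeta_zero]
    · simp [h]
  rw [Finset.sum_congr rfl this, Finset.sum_ite_eq']
  split_ifs <;> norm_num

lemma norm_oneC (l : ℤ) : ‖oneC l‖ ≤ if l = 0 then (1 : ℝ) else 0 := by
  unfold oneC; split_ifs <;> simp

lemma exists_Bd_pow (hab : a < b) (s : ℝ) (hs : 1 ≤ s) (A : ℝ) (n : ℕ) : ∃ C, 0 ≤ C ∧
    ∀ c : ℤ → ℂ, Bd a b s c A → Bd a b s (powC c n) C := by
  induction n with
  | zero => exact ⟨1, zero_le_one, fun c _ => Bd.of_W (W_oneC s) norm_oneC le_rfl⟩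
  | succ n ih =>
    obtain ⟨C, hC, h⟩ := ih
    obtain ⟨D, hD, h2⟩ := exists_Bd_conv hab s hs
    refine ⟨|D * (A * C)|, abs_nonneg _, fun c hc => ?_⟩
    exact (h2 c _ A C hc (h c hc)).mono (le_abs_self _)

lemma convC_sub_sub {c d P Q : ℤ → ℂ} {A B C D : ℝ} (hc : L2 (fun l => ‖c l‖) A)
    (hd : L2 (fun l => ‖d l‖) B) (hP : L2 (fun l => ‖P l‖) C) (hQ : L2 (fun l => ‖Q l‖) D) (l : ℤ) :
    convC c P l - convC d Q l =
      convC (fun l => c l - d l) P l + convC d (fun l => P l - Q l) l := by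
  have s1 := convC_summable hc hP (fun _ => le_rfl) (fun _ => le_rfl) l
  have s2 := convC_summable hd hP (fun _ => le_rfl) (fun _ => le_rfl) l
  have s3 := convC_summable hd hQ (fun _ => le_rfl) (fun _ => le_rfl) l
  have e1 : convC (fun l => c l - d l) P l = convC c P l - convC d P l := by
    unfold convC
    rw [← Summable.tsum_sub s1 s2]
    simp only [sub_mul]
  have e2 : convC d (fun l => P l - Q l) l = convC d P l - convC d Q l := by
    unfold convC
    rw [← Summable.tsum_sub s2 s3]
    simp only [mul_sub]
  rw [e1, e2]; ring

lemma exists_Bd_lip (hab : a < b) (s : ℝ) (hs : 1 ≤ s) (A : ℝ) (n : ℕ) : ∃ L, 0 ≤ L ∧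
    ∀ (c d : ℤ → ℂ) (δ : ℝ), Bd a b s c A → Bd a b s d A → Bd a b s (fun l => c l - d l) δ →
      Bd a b s (fun l => powC c n l - powC d n l) (L * δ) := by
  induction n with
  | zero =>
    refine ⟨1, zero_le_one, fun c d δ hc hd h => ?_⟩
    exact Bd.of_W h (fun l => by simp [powC]) (by simp)
  | succ n ih =>
    obtain ⟨L, hL, h⟩ := ih
    obtain ⟨D, hD, h2⟩ := exists_Bd_conv hab s hs
    obtain ⟨C, hC, h3⟩ := exists_Bd_pow hab s hs A n
    refine ⟨D * C + D * |A| * L, by positivity, fun c d δ hc hd hcd => ?_⟩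
    have hs0 : 0 ≤ s := by linarith
    have p1 := h3 c hc
    have p2 := h3 d hd
    have q1 := h2 _ _ _ _ hcd p1
    have q2 := h2 _ _ _ _ hd (h c d δ hc hd hcd)
    refine Bd.of_W (Bd.add q1 q2) (fun l => ?_) ?_
    · simp only [powC]
      rw [convC_sub_sub (hc.L2 hs0) (hd.L2 hs0) (p1.L2 hs0) (p2.L2 hs0)]
    · rw [abs_of_nonneg hc.nonneg]
      apply le_of_eq; ring

/-! mean value -/

lemma Bd.mv {s : ℝ} {u u' : ℝ → ℤ → ℂ} {T B : ℝ} (hT : 0 ≤ T)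
    (hd : ∀ t ∈ Set.Icc 0 T, ∀ l, HasDerivAt (fun t => u t l) (u' t l) t)
    (hB : ∀ t ∈ Set.Icc 0 T, Bd a b s (u' t) B) :
    Bd a b s (fun l => u T l - u 0 l) (B * T) := by
  have hB0 : 0 ≤ B := (hB 0 ⟨le_rfl, hT⟩).nonneg
  refine ⟨fun _ => norm_nonneg _, mul_nonneg hB0 hT, fun S => ?_⟩
  let f : ℝ → EuclideanSpace ℂ S := fun t => WithLp.toLp 2 (fun l : S => ((zeta a b l ^ s : ℝ) : ℂ) * u t l)
  let f' : ℝ → EuclideanSpace ℂ S := fun t => WithLp.toLp 2 (fun l : S => ((zeta a b l ^ s : ℝ) : ℂ) * u' t l)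
  have key := norm_image_sub_le_of_norm_deriv_le_segment' (f := f) (f' := f') (a := 0) (b := T) (C := B)
    (by
      intro t ht
      apply HasDerivAt.hasDerivWithinAt
      have h1 : HasDerivAt (fun t => (fun l : S => ((zeta a b l ^ s : ℝ) : ℂ) * u t l))
          (fun l : S => ((zeta a b l ^ s : ℝ) : ℂ) * u' t l) t := by
        rw [hasDerivAt_pi]
        intro l
        exact (hd t ht l).const_mul _
      exact ((PiLp.continuousLinearEquiv 2 ℝ (fun _ : S => ℂ)).symm.toContinuousLinearMap.hasFDerivAt.comp_hasDerivAt t h1))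
    (by
      intro t ht
      apply le_of_sq_le_sq _ hB0
      rw [EuclideanSpace.norm_sq_eq]
      have h := (hB t ⟨ht.1, ht.2.le⟩).2.2 S
      rw [← Finset.sum_coe_sort] at h
      refine le_trans (le_of_eq ?_) h
      apply Finset.sum_congr rfl
      intro l _
      simp only [f', norm_mul, Complex.norm_real, Real.norm_of_nonneg (zeta_rpow_pos s _).le])
    T ⟨hT, le_rfl⟩
  rw [sub_zero] at key
  have k2 := pow_le_pow_left₀ (norm_nonneg _) key 2
  rw [EuclideanSpace.norm_sq_eq] at k2
  refine le_trans (le_of_eq ?_) k2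
  rw [← Finset.sum_coe_sort]
  apply Finset.sum_congr rfl
  intro l _
  simp only [f, PiLp.sub_apply, ← mul_sub, norm_mul, Complex.norm_real,
    Real.norm_of_nonneg (zeta_rpow_pos s _).le]

/-! reality -/
lemma conjC_conv (c d : ℤ → ℂ) : conjC (convC c d) = convC (conjC c) (conjC d) := by
  funext l
  unfold conjC convC
  rw [Complex.conj_tsum, ← (Equiv.neg ℤ).tsum_eq]
  apply tsum_congr
  intro k
  simp only [Equiv.neg_apply, map_mul]
  congr 3
  ring

lemma conjC_pow {c : ℤ → ℂ} (hc : conjC c = c) (n : ℕ) : conjC (powC c n) = powC c n := by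
  induction n with
  | zero =>
    funext l
    simp [powC, conjC, oneC, apply_ite]
  | succ n ih => simp only [powC]; rw [conjC_conv, hc, ih]

lemma conjC_reC (c : ℤ → ℂ) : conjC (reC c) = reC c := by
  funext l
  have h2 : (starRingEnd ℂ) 2 = 2 := map_ofNat _ 2
  simp only [conjC, reC, map_div₀, map_add, neg_neg, h2, Complex.conj_conj]; ring

lemma conj_Gop (p : ℕ) (c : ℤ → ℂ) (l : ℤ) : (starRingEnd ℂ) (Gop p c (-l)) = Gop p c l :=
  congrFun (conjC_pow (conjC_reC c) (p + 1)) l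

/-! second differences -/
def D2 (u : ℝ → ℤ → ℂ) (f0 f1 f2 : ℤ → ℝ) : Prop :=
  (∀ t l, ‖u t l‖ ≤ f0 l) ∧ (∀ t s l, ‖u (t + s) l - u t l‖ ≤ |s| * f1 l) ∧
    (∀ t s l, ‖u (t + s) l + u (t - s) l - 2 * u t l‖ ≤ s ^ 2 * f2 l)

lemma D2.conv {u w : ℝ → ℤ → ℂ} {f0 f1 f2 g0 g1 g2 : ℤ → ℝ} {A0 A1 A2 B0 B1 B2 : ℝ}
    (hu : D2 u f0 f1 f2) (hw : D2 w g0 g1 g2) (h0 : L2 f0 A0) (h1 : L2 f1 A1) (h2 : L2 f2 A2)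
    (k0 : L2 g0 B0) (k1 : L2 g1 B1) (k2 : L2 g2 B2) :
    D2 (fun t => convC (u t) (w t)) (cv f0 g0) (fun l => cv f1 g0 l + cv f0 g1 l)
      (fun l => cv f2 g0 l + cv f0 g2 l + 2 * cv f1 g1 l) := by
  obtain ⟨u0, u1, u2⟩ := hu
  obtain ⟨w0, w1, w2⟩ := hw
  have S : ∀ t s l, Summable (fun k => u t k * w s (l - k)) := fun t s l =>
    convC_summable h0 k0 (u0 t) (w0 s) l
  have u0' : ∀ t l, ‖u t l‖ ≤ 1 * f0 l := by simpa using u0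
  have w0' : ∀ t l, ‖w t l‖ ≤ 1 * g0 l := by simpa using w0
  refine ⟨fun t l => ?_, fun t s l => ?_, fun t s l => ?_⟩
  · simpa using norm_convC_le h0 k0 (u0' t) (w0' t) l
  · have e : convC (u (t + s)) (w (t + s)) l - convC (u t) (w t) l =
      convC (fun l => u (t + s) l - u t l) (w (t + s)) l +
        convC (u t) (fun l => w (t + s) l - w t l) l := by
      unfold convC
      simp only [sub_mul, mul_sub]
      rw [(S _ _ l).tsum_sub (S _ _ l), (S _ _ l).tsum_sub (S _ _ l)]
      ring
    rw [e]
    have q1 := norm_convC_le h1 k0 (u1 t s) (w0' (t + s)) l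
    have q2 := norm_convC_le h0 k1 (u0' t) (w1 t s) l
    refine (norm_add_le _ _).trans ((add_le_add q1 q2).trans (le_of_eq (by ring)))
  · have e : convC (u (t + s)) (w (t + s)) l + convC (u (t - s)) (w (t - s)) l
          - 2 * convC (u t) (w t) l =
      convC (fun l => u (t + s) l + u (t - s) l - 2 * u t l) (w t) l +
        convC (u t) (fun l => w (t + s) l + w (t - s) l - 2 * w t l) l +
        convC (fun l => u (t + s) l - u t l) (fun l => w (t + s) l - w t l) l +
        convC (fun l => u (t + -s) l - u t l) (fun l => w (t + -s) l - w t l) l := by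
      unfold convC
      have T : ∀ t s, HasSum (fun k => u t k * w s (l - k)) (∑' k, u t k * w s (l - k)) :=
        fun t s => (S t s l).hasSum
      rw [← sub_eq_add_neg]
      have E1 := (((T (t + s) t).add (T (t - s) t)).sub ((T t t).mul_left 2))
      have E2 := (((T t (t + s)).add (T t (t - s))).sub ((T t t).mul_left 2))
      have E3 := ((T (t + s) (t + s)).sub (T (t + s) t)).sub ((T t (t + s)).sub (T t t))
      have E4 := ((T (t - s) (t - s)).sub (T (t - s) t)).sub ((T t (t - s)).sub (T t t))
      have F1 : ∀ k, (u (t + s) k + u (t - s) k - 2 * u t k) * w t (l - k) =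
        u (t + s) k * w t (l - k) + u (t - s) k * w t (l - k) - 2 * (u t k * w t (l - k)) :=
        fun k => by ring
      have F2 : ∀ k, u t k * (w (t + s) (l - k) + w (t - s) (l - k) - 2 * w t (l - k)) =
        u t k * w (t + s) (l - k) + u t k * w (t - s) (l - k) - 2 * (u t k * w t (l - k)) :=
        fun k => by ring
      have F3 : ∀ k, (u (t + s) k - u t k) * (w (t + s) (l - k) - w t (l - k)) =
        u (t + s) k * w (t + s) (l - k) - u (t + s) k * w t (l - k) -
          (u t k * w (t + s) (l - k) - u t k * w t (l - k)) := fun k => by ring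
      have F4 : ∀ k, (u (t - s) k - u t k) * (w (t - s) (l - k) - w t (l - k)) =
        u (t - s) k * w (t - s) (l - k) - u (t - s) k * w t (l - k) -
          (u t k * w (t - s) (l - k) - u t k * w t (l - k)) := fun k => by ring
      simp only [F1, F2, F3, F4]
      rw [E1.tsum_eq, E2.tsum_eq, E3.tsum_eq, E4.tsum_eq]
      ring
    rw [e]
    have q1 := norm_convC_le h2 k0 (u2 t s) (w0' t) l
    have q2 := norm_convC_le h0 k2 (u0' t) (w2 t s) l
    have q3 := norm_convC_le h1 k1 (u1 t s) (w1 t s) l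
    have q4 := norm_convC_le h1 k1 (u1 t (-s)) (w1 t (-s)) l
    rw [abs_mul_abs_self] at q3 q4
    refine (norm_add_le _ _).trans ((add_le_add ((norm_add_le _ _).trans (add_le_add
      ((norm_add_le _ _).trans (add_le_add q1 q2)) q3)) q4).trans (le_of_eq (by ring)))

def DD (a b m : ℝ) (u : ℝ → ℤ → ℂ) (B : ℝ) : Prop :=
  ∃ f0 f1 f2, D2 u f0 f1 f2 ∧ W a b (m + 1) f0 B ∧ W a b m f1 B ∧ W a b (m - 1) f2 B

lemma exists_DD_conv (hab : a < b) (m : ℝ) (hm : 1 ≤ m) : ∃ C, 0 ≤ C ∧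
    ∀ (u w : ℝ → ℤ → ℂ) (A B : ℝ), DD a b m u A → DD a b m w B →
      DD a b m (fun t => convC (u t) (w t)) (C * (A * B)) := by
  obtain ⟨C1, hC1, P1⟩ := exists_P1 hab (m + 1) (by linarith)
  obtain ⟨C2, hC2, P2⟩ := exists_P1 hab m hm
  obtain ⟨C3, hC3, P3⟩ := exists_P2 hab (m - 1) (by linarith)
  rw [sub_add_cancel] at P3
  refine ⟨C1 + 4 * C2 + 2 * C3, by positivity, fun u w A B hu hw => ?_⟩
  obtain ⟨f0, f1, f2, hu, h0, h1, h2⟩ := hu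
  obtain ⟨g0, g1, g2, hw, k0, k1, k2⟩ := hw
  have hA : 0 ≤ A := h0.2.1
  have hB : 0 ≤ B := k0.2.1
  have hAB : 0 ≤ A * B := mul_nonneg hA hB
  have m1 : 0 ≤ C1 * (A * B) := mul_nonneg hC1 hAB
  have m2 : 0 ≤ C2 * (A * B) := mul_nonneg hC2 hAB
  have m3 : 0 ≤ C3 * (A * B) := mul_nonneg hC3 hAB
  have h0' := h0.down (r := m) (by linarith)
  have k0' := k0.down (r := m) (by linarith)
  refine ⟨_, _, _, hu.conv hw (h0.L2 (by linarith)) (h1.L2 (by linarith)) (h2.L2 (by linarith))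
    (k0.L2 (by linarith)) (k1.L2 (by linarith)) (k2.L2 (by linarith)), ?_, ?_, ?_⟩
  · have := P1 _ _ _ _ h0 k0
    exact this.mono this.1 (fun _ => le_rfl) (by nlinarith)
  · have := (P2 _ _ _ _ h1 k0').add (P2 _ _ _ _ h0' k1)
    exact this.mono this.1 (fun _ => le_rfl) (by nlinarith)
  · have t1 := P3 _ _ _ _ k0' h2
    rw [cv_comm] at t1
    have t2 := P3 _ _ _ _ h0' k2
    have t3 := ((P2 _ _ _ _ h1 k1).down (r := m - 1) (by linarith)).smul (r := 2) (by norm_num)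
    have := (t1.add t2).add t3
    exact this.mono this.1 (fun _ => le_rfl) (by nlinarith)

lemma exists_DD_pow (hab : a < b) (m : ℝ) (hm : 1 ≤ m) (A : ℝ) (n : ℕ) : ∃ C, 0 ≤ C ∧
    ∀ u : ℝ → ℤ → ℂ, DD a b m u A → DD a b m (fun t => powC (u t) n) C := by
  induction n with
  | zero =>
    refine ⟨1, zero_le_one, fun u _ => ⟨_, fun _ => 0, fun _ => 0, ⟨fun t => norm_oneC, ?_, ?_⟩,
      W_oneC _, ?_, ?_⟩⟩
    · intro t s l; simp [powC]
    · intro t s l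
      simp only [powC]
      rw [← two_mul]; simp
    · exact (W_oneC m).mono (fun _ => le_rfl) (fun l => by split_ifs <;> norm_num) le_rfl
    · exact (W_oneC _).mono (fun _ => le_rfl) (fun l => by split_ifs <;> norm_num) le_rfl
  | succ n ih =>
    obtain ⟨C, hC, h⟩ := ih
    obtain ⟨D, hD, h2⟩ := exists_DD_conv hab m hm
    refine ⟨|D * (A * C)|, abs_nonneg _, fun u hu => ?_⟩
    obtain ⟨f0, f1, f2, q, w0, w1, w2⟩ := h2 _ _ _ _ hu (h u hu)
    exact ⟨f0, f1, f2, q, w0.mono w0.1 (fun _ => le_rfl) (le_abs_self _),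
      w1.mono w1.1 (fun _ => le_rfl) (le_abs_self _), w2.mono w2.1 (fun _ => le_rfl) (le_abs_self _)⟩

end
section
variable {a b : ℝ}

lemma ph_diff (t s x : ℝ) (hx : 0 ≤ x) :
    ‖Complex.exp (Complex.I * ((t + s : ℝ) : ℂ) * (x : ℂ)) - Complex.exp (Complex.I * (t : ℂ) * (x : ℂ))‖
      ≤ |s| * x := by
  have e : Complex.exp (Complex.I * ((t + s : ℝ) : ℂ) * (x : ℂ)) - Complex.exp (Complex.I * (t : ℂ) * (x : ℂ))
      = Complex.exp (Complex.I * (t : ℂ) * (x : ℂ)) * (Complex.exp (Complex.I * ((s * x : ℝ) : ℂ)) - 1) := by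
    rw [mul_sub, ← Complex.exp_add, mul_one]
    congr 2
    push_cast; ring
  rw [e, norm_mul, norm_ph, one_mul]
  refine Real.norm_exp_I_mul_ofReal_sub_one_le.trans ?_
  rw [Real.norm_eq_abs, abs_mul, abs_of_nonneg hx]

lemma ph_diff2 (t s x : ℝ) :
    ‖Complex.exp (Complex.I * ((t + s : ℝ) : ℂ) * (x : ℂ)) + Complex.exp (Complex.I * ((t - s : ℝ) : ℂ) * (x : ℂ))
      - 2 * Complex.exp (Complex.I * (t : ℂ) * (x : ℂ))‖ ≤ s ^ 2 * x ^ 2 := by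
  have e : Complex.exp (Complex.I * ((t + s : ℝ) : ℂ) * (x : ℂ)) + Complex.exp (Complex.I * ((t - s : ℝ) : ℂ) * (x : ℂ))
      - 2 * Complex.exp (Complex.I * (t : ℂ) * (x : ℂ))
      = Complex.exp (Complex.I * (t : ℂ) * (x : ℂ)) * ((2 * Real.cos (s * x) - 2 : ℝ) : ℂ) := by
    push_cast
    have h1 : Complex.I * ((t : ℂ) + s) * x = Complex.I * t * x + s * x * Complex.I := by ring
    have h2 : Complex.I * ((t : ℂ) - s) * x = Complex.I * t * x + -(s * x) * Complex.I := by ring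
    rw [h1, h2, Complex.two_cos, Complex.exp_add, Complex.exp_add]; ring
  rw [e, norm_mul, norm_ph, one_mul, Complex.norm_real, Real.norm_eq_abs, abs_le]
  have h1 := Real.one_sub_sq_div_two_le_cos (x := s * x)
  have h2 := Real.cos_le_one (s * x)
  constructor <;> nlinarith [sq_nonneg (s * x)]

lemma DD_free {m K : ℝ} {c : ℤ → ℂ} (hc : Bd a b (m + 1) c K) :
    DD a b m (fun t => reC (expJ a b t c)) K := by
  have h0 : W a b (m + 1) (fun l => (1 / 2) * (‖c l‖ + ‖c (-l)‖)) K := by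
    have := (W.add hc (W.neg hc)).smul (r := 1 / 2) (by norm_num)
    exact this.mono this.1 (fun _ => le_rfl) (le_of_eq (by ring))
  have h1 := h0.zmul
  have h2 := (h1.down (r := m - 1 + 1) (by linarith)).zmul
  refine ⟨_, _, _, ⟨fun t l => ?_, fun t s l => ?_, fun t s l => ?_⟩, h0, h1, h2⟩
  · have := norm_reC_le (expJ a b t c) l
    rwa [norm_expJ, norm_expJ] at this
  · rw [reC_sub]
    refine (norm_reC_le _ _).trans ?_
    have q : ∀ k, ‖expJ a b (t + s) c k - expJ a b t c k‖ ≤ |s| * zeta a b k * ‖c k‖ := by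
      intro k
      simp only [expJ, ← sub_mul, norm_mul]
      exact mul_le_mul_of_nonneg_right (ph_diff t s _ (zeta_pos k).le) (norm_nonneg _)
    have q1 := q l
    have q2 := q (-l)
    rw [zeta_neg] at q2
    nlinarith
  · have e : reC (expJ a b (t + s) c) l + reC (expJ a b (t - s) c) l - 2 * reC (expJ a b t c) l
       = reC (fun k => expJ a b (t + s) c k + expJ a b (t - s) c k - 2 * expJ a b t c k) l := by
      have h2 : (starRingEnd ℂ) 2 = 2 := map_ofNat _ 2
      simp only [reC, conjC, map_sub, map_add, map_mul, h2]; ring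
    rw [e]
    refine (norm_reC_le _ _).trans ?_
    have q : ∀ k, ‖expJ a b (t + s) c k + expJ a b (t - s) c k - 2 * expJ a b t c k‖
        ≤ s ^ 2 * zeta a b k ^ 2 * ‖c k‖ := by
      intro k
      simp only [expJ, ← mul_assoc, ← sub_mul, ← add_mul, norm_mul (_ - _) _]
      exact mul_le_mul_of_nonneg_right (ph_diff2 t s _) (norm_nonneg _)
    have q1 := q l
    have q2 := q (-l)
    rw [zeta_neg] at q2
    nlinarith

lemma norm_Fop (p : ℕ) (c : ℤ → ℂ) (l : ℤ) : ‖Fop a b p c l‖ = ‖Gop p c l‖ / zeta a b l := by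
  simp only [Fop, opJinv, norm_mul, Complex.norm_I, one_mul, norm_div, Complex.norm_real,
    Real.norm_of_nonneg (zeta_pos l).le]

lemma norm_Fop_sub (p : ℕ) (c d : ℤ → ℂ) (l : ℤ) :
    ‖Fop a b p c l - Fop a b p d l‖ = ‖Gop p c l - Gop p d l‖ / zeta a b l := by
  simp only [Fop, opJinv, ← mul_sub, ← sub_div, norm_mul, Complex.norm_I, one_mul, norm_div,
    Complex.norm_real, Real.norm_of_nonneg (zeta_pos l).le]

/-- second difference of the frozen twisted nonlinearity -/
lemma exists_midpoint (hab : a < b) (p : ℕ) (m : ℝ) (hm : 1 ≤ m) (K : ℝ) : ∃ C, 0 ≤ C ∧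
    ∀ c : ℤ → ℂ, Bd a b (m + 1) c K → ∀ t s : ℝ,
      Bd a b m (fun l => Ft a b p (t + s) c l + Ft a b p (t - s) c l - 2 * Ft a b p t c l)
        (s ^ 2 * C) := by
  obtain ⟨C, hC, h⟩ := exists_DD_pow hab m hm K (p + 1)
  refine ⟨C + C + 2 * C, by positivity, fun c hc t s => ?_⟩
  obtain ⟨f0, f1, f2, ⟨u0, u1, u2⟩, h0, h1, h2⟩ := h _ (DD_free hc)
  have w0 := ((h0.zmul).down (r := m - 1 + 1) (by linarith)).zmul
  have w1 := ((h1.down (r := m - 1 + 1) (by linarith)).zmul).smul (r := 2) (by norm_num)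
  have w := (((w0.add h2).add w1).zdiv).smul (sq_nonneg s)
  rw [sub_add_cancel] at w
  refine Bd.of_W w (fun l => ?_) le_rfl
  have hz := zeta_pos (a := a) (b := b) l
  set E : ℝ → ℂ := fun t => Complex.exp (Complex.I * ((-t : ℝ) : ℂ) * (zeta a b l : ℂ)) with hE
  set g : ℝ → ℂ := fun t => powC (reC (expJ a b t c)) (p + 1) l with hg
  have hF : ∀ t, Ft a b p t c l = (Complex.I / (zeta a b l : ℂ)) * (E t * g t) := by
    intro t
    rw [Ft, show ∀ t c l, expJ a b t c l = Complex.exp (Complex.I * (t : ℂ) * (zeta a b l : ℂ)) * c l from fun _ _ _ => rfl]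
    simp only [Fop, opJinv, Gop, E, g]
    ring
  have e : Ft a b p (t + s) c l + Ft a b p (t - s) c l - 2 * Ft a b p t c l =
      (Complex.I / (zeta a b l : ℂ)) * ((E (t + s) + E (t - s) - 2 * E t) * g t +
        E t * (g (t + s) + g (t - s) - 2 * g t) + (E (t + s) - E t) * (g (t + s) - g t) +
        (E (t + -s) - E t) * (g (t + -s) - g t)) := by
    rw [hF, hF, hF, ← sub_eq_add_neg]; ring
  rw [e, norm_mul, norm_div, Complex.norm_I, Complex.norm_real, Real.norm_of_nonneg hz.le]
  have E1 : ∀ s, ‖E (t + s) - E t‖ ≤ |s| * zeta a b l := by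
    intro s
    have := ph_diff (-t) (-s) (zeta a b l) hz.le
    rw [abs_neg] at this
    simp only [E, neg_add]
    exact this
  have E2 : ‖E (t + s) + E (t - s) - 2 * E t‖ ≤ s ^ 2 * zeta a b l ^ 2 := by
    have := ph_diff2 (-t) (-s) (zeta a b l)
    rw [neg_sq] at this
    simp only [E, neg_add, neg_sub']
    exact this
  have E0 : ‖E t‖ = 1 := norm_ph _ _
  have G0 : ‖g t‖ ≤ f0 l := u0 t l
  have G1 : ∀ s, ‖g (t + s) - g t‖ ≤ |s| * f1 l := fun s => u1 t s l
  have G2 : ‖g (t + s) + g (t - s) - 2 * g t‖ ≤ s ^ 2 * f2 l := u2 t s l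
  have z1 : ‖(E (t + s) + E (t - s) - 2 * E t) * g t‖ ≤ s ^ 2 * zeta a b l ^ 2 * f0 l := by
    rw [norm_mul]
    exact mul_le_mul E2 G0 (norm_nonneg _) (by positivity)
  have z2 : ‖E t * (g (t + s) + g (t - s) - 2 * g t)‖ ≤ s ^ 2 * f2 l := by
    rw [norm_mul, E0, one_mul]; exact G2
  have z3 : ∀ s, ‖(E (t + s) - E t) * (g (t + s) - g t)‖ ≤ s ^ 2 * (zeta a b l * f1 l) := by
    intro s
    rw [norm_mul]
    refine (mul_le_mul (E1 s) (G1 s) (norm_nonneg _) (by positivity)).trans (le_of_eq ?_)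
    rw [← sq_abs]; ring
  have z4 := z3 (-s)
  rw [neg_sq] at z4
  have tot := (norm_add_le _ _).trans (add_le_add ((norm_add_le _ _).trans (add_le_add
      ((norm_add_le _ _).trans (add_le_add z1 z2)) (z3 s))) z4)
  refine (mul_le_mul_of_nonneg_left tot (by positivity)).trans (le_of_eq ?_)
  ring

lemma hasDerivAt_ph (x t : ℝ) : HasDerivAt (fun t : ℝ => Complex.exp (Complex.I * (t : ℂ) * (x : ℂ)))
    (Complex.I * x * Complex.exp (Complex.I * (t : ℂ) * (x : ℂ))) t := by
  have h1 : HasDerivAt (fun t : ℝ => Complex.I * (t : ℂ) * (x : ℂ)) (Complex.I * 1 * x) t :=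
    ((Complex.ofRealCLM.hasDerivAt (x := t)).const_mul Complex.I).mul_const (x : ℂ)
  have := h1.cexp
  refine this.congr_deriv ?_
  ring

lemma hasDerivAt_expJ (c : ℤ → ℂ) (l : ℤ) (t : ℝ) : HasDerivAt (fun t : ℝ => expJ a b t c l)
    (Complex.I * zeta a b l * expJ a b t c l) t := by
  have := (hasDerivAt_ph (zeta a b l) t).mul_const (c l)
  refine this.congr_deriv ?_
  simp only [expJ]; ring

lemma hasDerivAt_phi {p : ℕ} {ε : ℝ} {Ψ : ℝ → ℤ → ℂ} (h : IsExactSol a b p ε Ψ) (l : ℤ) (t : ℝ) :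
    HasDerivAt (fun t => expJ a b (-t) (Ψ t) l)
      (((ε ^ p : ℝ) : ℂ) * expJ a b (-t) (Fop a b p (Ψ t)) l) t := by
  have h1 : HasDerivAt (fun t : ℝ => Complex.exp (Complex.I * ((-t : ℝ) : ℂ) * (zeta a b l : ℂ)))
      (-(Complex.I * zeta a b l * Complex.exp (Complex.I * ((-t : ℝ) : ℂ) * (zeta a b l : ℂ)))) t := by
    have := (hasDerivAt_ph (zeta a b l) (-t)).scomp t (hasDerivAt_neg t)
    simpa [Function.comp_def] using this
  have := h1.mul (h t l)
  refine this.congr_deriv ?_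
  have hz : (zeta a b l : ℂ) ≠ 0 := by exact_mod_cast (zeta_pos l).ne'
  simp only [expJ, Fop, opJinv]
  push_cast
  field_simp
  ring

lemma expJ_expJ (s t : ℝ) (c : ℤ → ℂ) (l : ℤ) : expJ a b s (expJ a b t c) l = expJ a b (s + t) c l := by
  simp only [expJ]
  rw [← mul_assoc, ← Complex.exp_add]
  congr 2
  push_cast; ring

lemma expJ_zero (c : ℤ → ℂ) (l : ℤ) : expJ a b 0 c l = c l := by
  simp [expJ]

lemma expJ_sub (t : ℝ) (c d : ℤ → ℂ) (l : ℤ) :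
    expJ a b t (fun l => c l - d l) l = expJ a b t c l - expJ a b t d l := by
  simp only [expJ]; ring

lemma Bd.Fop {s : ℝ} {p : ℕ} {c : ℤ → ℂ} {B : ℝ} (h : Bd a b s (Gop p c) B) :
    Bd a b (s + 1) (Fop a b p c) B :=
  Bd.of_W (W.zdiv h) (fun l => (norm_Fop p c l).le) le_rfl

lemma Bd.smulr {s : ℝ} {c : ℤ → ℂ} {B r : ℝ} (h : Bd a b s c B) (hr : 0 ≤ r) :
    Bd a b s (fun l => (r : ℂ) * c l) (r * B) :=
  Bd.of_W (W.smul h hr) (fun l => by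
    rw [norm_mul, Complex.norm_real, Real.norm_of_nonneg hr]) le_rfl

lemma Bd.down {s r : ℝ} {c : ℤ → ℂ} {A : ℝ} (hf : Bd a b s c A) (h : r ≤ s) : Bd a b r c A :=
  W.down hf h

/-- real part of the deviation from the free flow is second order -/
lemma dev_bound {p : ℕ} {m ε τ C1 : ℝ} {Ψ : ℝ → ℤ → ℂ} (hε : 0 < ε) (h : IsExactSol a b p ε Ψ)
    (hC : ∀ t ∈ Set.Icc 0 τ, Bd a b m (Gop p (Ψ t)) C1) (t : ℝ) (ht : t ∈ Set.Icc 0 τ) :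
    Bd a b m (fun l => reC (Ψ t) l - reC (expJ a b t (Ψ 0)) l) (ε ^ p * C1 * τ ^ 2) := by
  have hτ : 0 ≤ τ := ht.1.trans ht.2
  have hεp : 0 < ε ^ p := pow_pos hε p
  have hC1 : 0 ≤ C1 := (hC t ht).nonneg
  -- first order
  have w1 : ∀ t ∈ Set.Icc 0 τ, Bd a b (m + 1) (fun l => Ψ t l - expJ a b t (Ψ 0) l) (ε ^ p * C1 * τ) := by
    intro t ht
    have := Bd.mv (a := a) (b := b) (s := m + 1) (u := fun t l => expJ a b (-t) (Ψ t) l)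
      (u' := fun t l => ((ε ^ p : ℝ) : ℂ) * expJ a b (-t) (Fop a b p (Ψ t)) l)
      (T := t) (B := ε ^ p * C1) ht.1 (fun t _ l => hasDerivAt_phi h l t)
      (fun r hr => ((hC r ⟨hr.1, hr.2.trans ht.2⟩).Fop.expJ (-r)).smulr hεp.le)
    refine Bd.of_W (this.expJ t) (fun l => ?_)
      (mul_le_mul_of_nonneg_left ht.2 (mul_nonneg hεp.le hC1))
    rw [expJ_sub t (fun l => expJ a b (-t) (Ψ t) l) (fun l => expJ a b (-0) (Ψ 0) l)]
    have e1 : expJ a b t (fun l => expJ a b (-t) (Ψ t) l) l = Ψ t l := by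
      have := expJ_expJ (a := a) (b := b) t (-t) (Ψ t) l
      rw [add_neg_cancel, expJ_zero] at this
      exact this
    have e2 : expJ a b t (fun l => expJ a b (-0) (Ψ 0) l) l = expJ a b t (Ψ 0) l := by
      have := expJ_expJ (a := a) (b := b) t (-0) (Ψ 0) l
      rw [neg_zero, add_zero] at this
      simpa using this
    rw [e1, e2]
  set w : ℝ → ℤ → ℂ := fun t l => Ψ t l - expJ a b t (Ψ 0) l with hw
  have hd : ∀ t l, HasDerivAt (fun t => reC (w t) l)
      (Complex.I * zeta a b l * ((w t l - conjC (w t) l) / 2)) t := by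
    intro t l
    have d1 := (h t l).sub (hasDerivAt_expJ (a := a) (b := b) (Ψ 0) l t)
    have d2 := ((h t (-l)).sub (hasDerivAt_expJ (a := a) (b := b) (Ψ 0) (-l) t)).star
    have := (d1.add d2).div_const 2
    refine this.congr_deriv ?_
    have hG := conj_Gop p (Ψ t) l
    rw [← starRingEnd_apply]
    simp only [map_sub, map_mul, map_add, map_div₀, map_pow, hG, Complex.conj_I,
      Complex.conj_ofReal, zeta_neg, conjC, w]
    ring
  have := Bd.mv (a := a) (b := b) (s := m) (u := fun t l => reC (w t) l)
      (u' := fun t l => Complex.I * zeta a b l * ((w t l - conjC (w t) l) / 2))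
      (T := t) (B := ε ^ p * C1 * τ) ht.1 (fun t _ l => hd t l)
      (fun r hr => by
        have hwr := w1 r ⟨hr.1, hr.2.trans ht.2⟩
        have h0 := ((W.add hwr (W.neg hwr)).smul (r := 1 / 2) (by norm_num)).zmul
        refine Bd.of_W h0 (fun l => ?_) (le_of_eq (by ring))
        rw [norm_mul, norm_mul, Complex.norm_I, one_mul, Complex.norm_real,
          Real.norm_of_nonneg (zeta_pos l).le]
        refine mul_le_mul_of_nonneg_left ?_ (zeta_pos l).le
        rw [norm_div, Complex.norm_ofNat]
        have q := norm_sub_le (w r l) (conjC (w r) l)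
        have q2 : ‖conjC (w r) l‖ = ‖w r (-l)‖ := by simp only [conjC, RCLike.norm_conj]
        rw [q2] at q
        simp only [w] at q ⊢
        linarith)
  refine Bd.of_W this (fun l => ?_) ?_
  · rw [reC_sub]
    have e0 : reC (w 0) l = 0 := by
      simp [reC, conjC, w, expJ_zero]
    simp only [e0, sub_zero, w]
    exact le_rfl
  · have : ε ^ p * C1 * τ * t ≤ ε ^ p * C1 * τ * τ :=
      mul_le_mul_of_nonneg_left ht.2 (by positivity)
    linarith

lemma local_err (hab : a < b) (p : ℕ) (m : ℝ) (hm : 1 ≤ m) (K : ℝ) : ∃ C, 0 ≤ C ∧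
    ∀ (ε : ℝ), 0 < ε → ε ≤ 1 → ∀ Ψ : ℝ → ℤ → ℂ, IsExactSol a b p ε Ψ → ∀ τ : ℝ, 0 < τ →
      (∀ t ∈ Set.Icc 0 τ, Bd a b (m + 1) (Ψ t) K) →
      Bd a b m (fun l => strang a b p ε τ (Ψ 0) l - Ψ τ l) (C * ε ^ p * τ ^ 3) := by
  obtain ⟨C1, hC1, H1⟩ := exists_Bd_pow hab m hm K (p + 1)
  obtain ⟨L, hL, H2⟩ := exists_Bd_lip hab m hm K (p + 1)
  obtain ⟨C2, hC2, H3⟩ := exists_midpoint hab p m hm K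
  refine ⟨L * C1 + C2, by positivity, fun ε hε hε1 Ψ h τ hτ hK => ?_⟩
  have hεp : 0 < ε ^ p := pow_pos hε p
  have hεp1 : ε ^ p ≤ 1 := pow_le_one₀ hε.le hε1
  have hKm : ∀ t ∈ Set.Icc 0 τ, Bd a b m (Ψ t) K := fun t ht => (hK t ht).down (by linarith)
  have h00 : (0 : ℝ) ∈ Set.Icc 0 τ := ⟨le_rfl, hτ.le⟩
  have hG : ∀ t ∈ Set.Icc 0 τ, Bd a b m (Gop p (Ψ t)) C1 := fun t ht => H1 _ (hKm t ht).reC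
  have hGd : ∀ t ∈ Set.Icc 0 τ, Bd a b m
      (fun l => expJ a b (-t) (Fop a b p (Ψ t)) l - Ft a b p t (Ψ 0) l) (L * (ε ^ p * C1 * τ ^ 2)) := by
    intro t ht
    have := H2 _ _ _ (hKm t ht).reC ((hKm 0 h00).expJ t).reC (dev_bound hε h hG t ht)
    refine Bd.of_W (W.zdiv this |>.down (by linarith)) (fun l => ?_) le_rfl
    unfold Ft
    rw [← expJ_sub, norm_expJ, norm_Fop_sub]
    exact le_rfl
  have der : ∀ (s : ℝ) (l : ℤ), HasDerivAt (fun s : ℝ => expJ a b (-(τ / 2 + s)) (Ψ (τ / 2 + s)) l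
        - expJ a b (-(τ / 2 - s)) (Ψ (τ / 2 - s)) l
        - (s : ℂ) * (2 * ((ε ^ p : ℝ) : ℂ) * Ft a b p (τ / 2) (Ψ 0) l))
      (((ε ^ p : ℝ) : ℂ) * (expJ a b (-(τ / 2 + s)) (Fop a b p (Ψ (τ / 2 + s))) l
        + expJ a b (-(τ / 2 - s)) (Fop a b p (Ψ (τ / 2 - s))) l - 2 * Ft a b p (τ / 2) (Ψ 0) l)) s := by
    intro s l
    have d1 := (hasDerivAt_phi h l (τ / 2 + s)).comp_const_add (τ / 2) s
    have d2 := (hasDerivAt_phi h l (τ / 2 - s)).comp_const_sub (τ / 2) s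
    have d3 := (Complex.ofRealCLM.hasDerivAt (x := s)).mul_const
      (2 * ((ε ^ p : ℝ) : ℂ) * Ft a b p (τ / 2) (Ψ 0) l)
    have := (d1.sub d2).sub d3
    refine this.congr_deriv ?_
    simp only [Complex.ofRealCLM_apply, Complex.ofReal_one]
    ring
  have main := Bd.mv (a := a) (b := b) (s := m)
    (T := τ / 2) (B := ε ^ p * (L * (ε ^ p * C1 * τ ^ 2) + L * (ε ^ p * C1 * τ ^ 2) + τ ^ 2 * C2))
    (by positivity) (fun s _ l => der s l)
    (fun s hs => by
      have t1 := hGd (τ / 2 + s) ⟨by linarith [hs.1], by linarith [hs.2]⟩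
      have t2 := hGd (τ / 2 - s) ⟨by linarith [hs.2], by linarith [hs.1]⟩
      have t3 := H3 _ (hK 0 h00) (τ / 2) s
      have t4 := t3.mono (B := τ ^ 2 * C2) (mul_le_mul_of_nonneg_right
        (pow_le_pow_left₀ hs.1 (by linarith [hs.2]) 2) hC2)
      refine Bd.of_W (((t1.add t2).add t4).smulr hεp.le) (fun l => le_of_eq ?_) le_rfl
      congr 2
      ring)
  refine Bd.of_W (main.expJ τ) (fun l => le_of_eq ?_) ?_
  · rw [norm_expJ, ← norm_neg, neg_sub]
    have e1 : strang a b p ε τ (Ψ 0) l = expJ a b τ (fun l => Ψ 0 l +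
        ((τ / 2 : ℝ) : ℂ) * (2 * ((ε ^ p : ℝ) : ℂ) * Ft a b p (τ / 2) (Ψ 0) l)) l := by
      simp only [strang, Ft]
      have hE : ∀ t c l, expJ a b t c l = Complex.exp (Complex.I * (t : ℂ) * (zeta a b l : ℂ)) * c l :=
        fun _ _ _ => rfl
      rw [hE (τ / 2), hE τ, hE (-(τ / 2))]
      simp only [flowV]
      rw [hE (τ / 2) (Ψ 0) l]
      have e2 : Complex.exp (Complex.I * (τ : ℂ) * (zeta a b l : ℂ)) =
        Complex.exp (Complex.I * ((τ / 2 : ℝ) : ℂ) * (zeta a b l : ℂ)) *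
        Complex.exp (Complex.I * ((τ / 2 : ℝ) : ℂ) * (zeta a b l : ℂ)) := by
        rw [← Complex.exp_add]; congr 1; push_cast; ring
      have e3 : Complex.exp (Complex.I * ((τ / 2 : ℝ) : ℂ) * (zeta a b l : ℂ)) *
        Complex.exp (Complex.I * ((-(τ / 2) : ℝ) : ℂ) * (zeta a b l : ℂ)) = 1 := by
        rw [← Complex.exp_add, ← Complex.exp_zero]; congr 1; push_cast; ring
      rw [e2, Complex.real_smul]
      push_cast at e3 ⊢
      linear_combination (-(Complex.exp (Complex.I * ((τ : ℂ) / 2) * (zeta a b l : ℂ)) * (ε : ℂ) ^ p * (τ : ℂ)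
        * Fop a b p (expJ a b (τ / 2) (Ψ 0)) l)) * e3
    have e4 : Ψ τ l = expJ a b τ (expJ a b (-τ) (Ψ τ)) l := by
      rw [expJ_expJ, add_neg_cancel, expJ_zero]
    rw [e1, e4, ← expJ_sub, norm_expJ]
    simp only [add_halves, sub_self, neg_zero, expJ_zero, add_zero, sub_zero, Complex.ofReal_zero, zero_mul]
    congr 1
    ring
  · have hc : 0 ≤ L * C1 * ε ^ p * τ ^ 3 := by positivity
    have hc2 : 0 ≤ C2 * ε ^ p * τ ^ 3 := by positivity
    have hc3 : L * C1 * ε ^ p * τ ^ 3 * ε ^ p ≤ L * C1 * ε ^ p * τ ^ 3 :=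
      mul_le_of_le_one_right hc hεp1
    nlinarith

lemma stab (hab : a < b) (p : ℕ) (m : ℝ) (hm : 1 ≤ m) (A : ℝ) : ∃ L, 0 ≤ L ∧
    ∀ (ε τ δ : ℝ) (c d : ℤ → ℂ), 0 < ε → 0 < τ → Bd a b m c A → Bd a b m d A →
      Bd a b m (fun l => c l - d l) δ →
      Bd a b m (fun l => strang a b p ε τ c l - strang a b p ε τ d l) ((1 + ε ^ p * τ * L) * δ) := by
  obtain ⟨L, hL, H⟩ := exists_Bd_lip hab m hm A (p + 1)
  refine ⟨L, hL, fun ε τ δ c d hε hτ hc hd h => ?_⟩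
  have hr : Bd a b m (fun l => expJ a b (τ / 2) c l - expJ a b (τ / 2) d l) δ :=
    Bd.of_W h (fun l => by rw [← expJ_sub, norm_expJ]) le_rfl
  have hre : Bd a b m (fun l => reC (expJ a b (τ / 2) c) l - reC (expJ a b (τ / 2) d) l) δ :=
    Bd.of_W hr.reC (fun l => by rw [reC_sub]) le_rfl
  have hG := H _ _ _ (hc.expJ (τ / 2)).reC (hd.expJ (τ / 2)).reC hre
  have hF : Bd a b m (fun l => Fop a b p (expJ a b (τ / 2) c) l - Fop a b p (expJ a b (τ / 2) d) l) (L * δ) :=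
    Bd.of_W ((W.zdiv hG).down (by linarith)) (fun l => (norm_Fop_sub _ _ _ _).le) le_rfl
  have hετ : 0 ≤ ε ^ p * τ := by positivity
  refine Bd.of_W (hr.add (hF.smulr hετ)) (fun l => le_of_eq ?_) (le_of_eq (by ring))
  unfold strang
  rw [← expJ_sub, norm_expJ]
  simp only [flowV, Complex.real_smul]
  congr 1
  ring

lemma weight_eq (s : ℝ) (c : ℤ → ℂ) (l : ℤ) :
    (1 + mu a b l ^ 2) ^ s * ‖c l‖ ^ 2 = (zeta a b l ^ s * ‖c l‖) ^ 2 := by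
  rw [← zeta_sq, mul_pow, Real.rpow_pow_comm (zeta_pos l).le]

lemma Bd.sobNorm_le {s : ℝ} {c : ℤ → ℂ} {B : ℝ} (h : Bd a b s c B) : sobNorm a b s c ≤ B := by
  unfold sobNorm sobNormSq
  simp only [weight_eq]
  apply Real.sqrt_le_iff.2 ⟨h.nonneg, ?_⟩
  exact Real.tsum_le_of_sum_le (fun _ => sq_nonneg _) h.2.2

lemma Bd.of_mem {s : ℝ} {c : ℤ → ℂ} {B : ℝ} (hB : 0 ≤ B) (h : MemHs a b s c) (h2 : sobNorm a b s c ≤ B) :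
    Bd a b s c B := by
  unfold MemHs at h
  unfold sobNorm sobNormSq at h2
  simp only [weight_eq] at h h2
  refine ⟨fun _ => norm_nonneg _, hB, fun S => ?_⟩
  have := (Real.sqrt_le_left hB).1 h2
  exact (h.sum_le_tsum S (fun _ _ => sq_nonneg _)).trans this

lemma Bd.mem {s : ℝ} {c : ℤ → ℂ} {B : ℝ} (h : Bd a b s c B) : MemHs a b s c := by
  unfold MemHs
  simp only [weight_eq]
  exact h.2.summable
end

theorem strang_global_error (a b : ℝ) (hab : a < b) (p : ℕ) (hp : 1 ≤ p)
    (m : ℝ) (hm : 1 ≤ m) (β : ℝ) (hβ0 : 0 ≤ β) (hβp : β ≤ (p : ℝ))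
    (T₀ R K : ℝ) (hT₀ : 0 < T₀) (hR : 0 < R) (hK : 0 < K) :
    ∃ τ₀ > 0, ∃ M₁ > 0, ∀ (ε : ℝ), 0 < ε → ε ≤ 1 →
      ∀ Ψ : ℝ → ℤ → ℂ, IsExactSol a b p ε Ψ →
        (∀ t : ℝ, 0 ≤ t → t ≤ T₀ / ε ^ β →
          MemHs a b (m + 1) (Ψ t) ∧ sobNorm a b m (Ψ t) ≤ R ∧
            sobNorm a b (m + 1) (Ψ t) ≤ K) →
      ∀ (τ : ℝ), 0 < τ → τ ≤ τ₀ * ε ^ ((β - (p : ℝ)) / 2) →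
      ∀ ψn : ℕ → ℤ → ℂ, ψn 0 = Ψ 0 →
        (∀ n : ℕ, ψn (n + 1) = strang a b p ε τ (ψn n)) →
      ∀ n : ℕ, (n : ℝ) * τ ≤ T₀ / ε ^ β →
        sobNorm a b m (fun l => ψn n l - Ψ ((n : ℝ) * τ) l) ≤
            M₁ * ε ^ ((p : ℝ) - β) * τ ^ 2 ∧
          sobNorm a b m (ψn n) ≤ R + 1 := by
  obtain ⟨C, hC, HC⟩ := local_err hab p m hm K
  obtain ⟨L, hL, HL⟩ := stab hab p m hm (R + 1)
  set M := (C + 1) * T₀ * Real.exp (L * T₀) with hM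
  have hMpos : 0 < M := by positivity
  refine ⟨1 / Real.sqrt M, by positivity, M, hMpos, ?_⟩
  intro ε hε hε1 Ψ hΨ hbd τ hτ hττ ψn h0 hstep
  have hεp : 0 < ε ^ p := pow_pos hε p
  have hεβ : 0 < ε ^ β := Real.rpow_pos_of_pos hε β
  have BK : ∀ t, 0 ≤ t → t ≤ T₀ / ε ^ β → Bd a b (m + 1) (Ψ t) K := fun t h1 h2 =>
    Bd.of_mem hK.le (hbd t h1 h2).1 (hbd t h1 h2).2.2
  have BR : ∀ t, 0 ≤ t → t ≤ T₀ / ε ^ β → Bd a b m (Ψ t) R := fun t h1 h2 =>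
    Bd.of_mem hR.le ((BK t h1 h2).down (by linarith)).mem (hbd t h1 h2).2.1
  have hpβ : ε ^ ((p : ℝ) - β) = ε ^ p / ε ^ β := by
    rw [Real.rpow_sub hε, Real.rpow_natCast]
  have hpβ1 : ε ^ ((p : ℝ) - β) ≤ 1 := Real.rpow_le_one hε.le hε1 (by linarith)
  have hpβ0 : 0 < ε ^ ((p : ℝ) - β) := Real.rpow_pos_of_pos hε _
  -- smallness
  have hsmall : M * ε ^ ((p : ℝ) - β) * τ ^ 2 ≤ 1 := by
    have h1 : τ ^ 2 ≤ (1 / Real.sqrt M * ε ^ ((β - (p : ℝ)) / 2)) ^ 2 :=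
      pow_le_pow_left₀ hτ.le hττ 2
    have h2 : (ε ^ ((β - (p : ℝ)) / 2)) ^ 2 = (ε ^ ((p : ℝ) - β))⁻¹ := by
      rw [← Real.rpow_natCast, ← Real.rpow_mul hε.le, ← Real.rpow_neg hε.le]
      congr 1
      push_cast; ring
    rw [mul_pow, h2, div_pow, Real.sq_sqrt hMpos.le, one_pow] at h1
    calc M * ε ^ ((p : ℝ) - β) * τ ^ 2
        ≤ M * ε ^ ((p : ℝ) - β) * (1 / M * (ε ^ ((p : ℝ) - β))⁻¹) := by gcongr
      _ = 1 := by field_simp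
  -- error quantity
  have herr : ∀ n : ℕ, (n : ℝ) * τ ≤ T₀ / ε ^ β →
      n * (C * ε ^ p * τ ^ 3) * (1 + ε ^ p * τ * L) ^ n ≤ M * ε ^ ((p : ℝ) - β) * τ ^ 2 := by
    intro n hn
    have hx : ε ^ p * (n * τ) ≤ T₀ * ε ^ ((p : ℝ) - β) := by
      rw [hpβ]
      calc ε ^ p * (n * τ) ≤ ε ^ p * (T₀ / ε ^ β) := by gcongr
        _ = _ := by ring
    have hx2 : ε ^ p * (n * τ) ≤ T₀ := hx.trans (mul_le_of_le_one_right hT₀.le hpβ1)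
    have h1 : (1 + ε ^ p * τ * L) ^ n ≤ Real.exp (L * T₀) := by
      calc (1 + ε ^ p * τ * L) ^ n ≤ (Real.exp (ε ^ p * τ * L)) ^ n := by
            apply pow_le_pow_left₀ (by positivity)
            linarith [Real.add_one_le_exp (ε ^ p * τ * L)]
        _ = Real.exp (L * (ε ^ p * (n * τ))) := by
            rw [← Real.exp_nat_mul]; congr 1; ring
        _ ≤ _ := by gcongr
    calc n * (C * ε ^ p * τ ^ 3) * (1 + ε ^ p * τ * L) ^ n
        = C * τ ^ 2 * (ε ^ p * (n * τ)) * (1 + ε ^ p * τ * L) ^ n := by ring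
      _ ≤ (C + 1) * τ ^ 2 * (T₀ * ε ^ ((p : ℝ) - β)) * Real.exp (L * T₀) := by
          gcongr
          linarith
      _ = _ := by rw [hM]; ring
  have key : ∀ n : ℕ, (n : ℝ) * τ ≤ T₀ / ε ^ β →
      Bd a b m (fun l => ψn n l - Ψ ((n : ℝ) * τ) l)
        (n * (C * ε ^ p * τ ^ 3) * (1 + ε ^ p * τ * L) ^ n) := by
    intro n
    induction n with
    | zero =>
      intro hn
      have : Bd a b m (fun _ => (0 : ℂ)) 0 := by
        refine ⟨fun _ => norm_nonneg _, le_rfl, fun S => by simp⟩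
      refine Bd.of_W this (fun l => ?_) (by simp)
      simp [h0]
    | succ n ih =>
      intro hn
      have hn' : (n : ℝ) * τ ≤ T₀ / ε ^ β := by
        refine le_trans ?_ hn
        push_cast
        nlinarith
      have hn0 : (0 : ℝ) ≤ n * τ := by positivity
      have ih' := ih hn'
      have he := (herr n hn').trans hsmall
      have b1 := BR _ hn0 hn'
      have b2 : Bd a b m (ψn n) (R + 1) := by
        refine Bd.of_W (ih'.add b1) (fun l => le_of_eq (by simp)) (by linarith)
      have s1 := HL ε τ _ _ _ hε hτ b2 (b1.mono (by linarith)) ih'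
      have hsol : IsExactSol a b p ε (fun s => Ψ ((n : ℝ) * τ + s)) := fun t l =>
        (hΨ ((n : ℝ) * τ + t) l).comp_const_add ((n : ℝ) * τ) t
      have s2 := HC ε hε hε1 _ hsol τ hτ (fun t ht => BK _ (by linarith [ht.1]) (by
        refine le_trans ?_ hn
        push_cast
        linarith [ht.2]))
      simp only [add_zero] at s2
      refine Bd.of_W (s1.add s2) (fun l => le_of_eq ?_) ?_
      · rw [hstep]
        congr 1
        have : ((n + 1 : ℕ) : ℝ) * τ = (n : ℝ) * τ + τ := by push_cast; ring
        rw [this]; ring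
      · have q : 1 ≤ (1 + ε ^ p * τ * L) ^ (n + 1) := one_le_pow₀ (by
          have : 0 ≤ ε ^ p * τ * L := by positivity
          linarith)
        have q2 : C * ε ^ p * τ ^ 3 ≤ C * ε ^ p * τ ^ 3 * (1 + ε ^ p * τ * L) ^ (n + 1) :=
          le_mul_of_one_le_right (by positivity) q
        push_cast
        have e : (1 + ε ^ p * τ * L) * ((n:ℝ) * (C * ε ^ p * τ ^ 3) * (1 + ε ^ p * τ * L) ^ n)
            = n * (C * ε ^ p * τ ^ 3 * (1 + ε ^ p * τ * L) ^ (n + 1)) := by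
          rw [pow_succ (1 + ε ^ p * τ * L) n]; ring
        have e2 : ((n:ℝ) + 1) * (C * ε ^ p * τ ^ 3) * (1 + ε ^ p * τ * L) ^ (n + 1)
            = n * (C * ε ^ p * τ ^ 3 * (1 + ε ^ p * τ * L) ^ (n + 1))
              + C * ε ^ p * τ ^ 3 * (1 + ε ^ p * τ * L) ^ (n + 1) := by ring
        rw [e2, e]
        linarith
  intro n hn
  have k := key n hn
  have he := herr n hn
  refine ⟨k.sobNorm_le.trans he, ?_⟩
  have b1 := BR _ (by positivity) hn
  have b2 : Bd a b m (ψn n) (R + 1) := by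
    refine Bd.of_W (k.add b1) (fun l => le_of_eq (by simp)) (by linarith)
  exact b2.sobNorm_le

end NKGE
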